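/- Let A be a unital C*-algebra, (a_j)_{j≥1} a CAR family over the positive integers in A, and (α_g)_{g∈ℙ_ℕ} a family of *-algebra automorphisms of A implementing the finite permutations. Then the set of extreme points of the convex set of symmetric states on A is closed in the weak-* topology on the continuous dual of A. -/

import Mathlib

open scoped ComplexOrder

/-- A CAR family over `J` in `A`: a family satisfying the canonical anticommutation
relations and generating `A` as a closed *-subalgebra. -/
def IsCARFamily {J : Type*} {A : Type*} [NormedRing A] [StarRing A] [CStarRing A]
    [NormedAlgebra ℂ A] [StarModule ℂ A] [CompleteSpace A] (a : J → A) : Prop :=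
  (∀ j : J, star (a j) * a j + a j * star (a j) = 1) ∧
  (∀ j k : J, j ≠ k → star (a j) * a k + a k * star (a j) = 0) ∧
  (∀ j k : J, a j * a k + a k * a j = 0) ∧
  (StarAlgebra.adjoin ℂ (Set.range a)).topologicalClosure = ⊤

/-- A permutation moving only finitely many points. -/
def IsFinitePerm {J : Type*} (g : Equiv.Perm J) : Prop :=
  {j : J | g j ≠ j}.Finite

/-- The convex set of symmetric states inside the weak-* dual: continuous linear
functionals `ψ` with `ψ 1 = 1`, `ψ(x*x) ≥ 0`, invariant under all the automorphisms
implementing finite permutations. -/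
def SymmetricStatesWeakDual {J : Type*} {A : Type*} [NormedRing A] [StarRing A]
    [CStarRing A] [NormedAlgebra ℂ A] [StarModule ℂ A] [CompleteSpace A]
    (α : Equiv.Perm J → (A ≃⋆ₐ[ℂ] A)) : Set (WeakDual ℂ A) :=
  {ψ | ψ 1 = 1 ∧ (∀ x : A, 0 ≤ ψ (star x * x)) ∧
    ∀ g : Equiv.Perm J, IsFinitePerm g → ∀ x : A, ψ (α g x) = ψ x}

section helpers

set_option linter.unusedSectionVars false

variable {A : Type*} [NormedRing A] [StarRing A] [CStarRing A] [NormedAlgebra ℂ A]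
  [StarModule ℂ A] [CompleteSpace A]

theorem car_sqrt_exists (b : A) (hb : star b = b) (hn : ‖b‖ ≤ 1) :
    ∃ k : A, 1 + b = star k * k := by
  let : CStarAlgebra A := {}
  let := CStarAlgebra.spectralOrder A
  let := CStarAlgebra.spectralOrderedRing A
  have h1 : IsSelfAdjoint (-b) := by
    rw [IsSelfAdjoint, star_neg, hb]
  have h2 := h1.le_algebraMap_norm_self
  rw [norm_neg] at h2
  have h3 : algebraMap ℝ A ‖b‖ ≤ algebraMap ℝ A 1 := algebraMap_mono A hn
  have h4 : 0 ≤ 1 + b := by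
    have h5 := h2.trans h3
    rw [map_one] at h5
    have := sub_nonneg.mpr h5
    simpa using this
  exact CStarAlgebra.nonneg_iff_eq_star_mul_self.mp h4

theorem car_norm_aut (β : A ≃⋆ₐ[ℂ] A) (x : A) : ‖β x‖ = ‖x‖ := by
  let : CStarAlgebra A := {}
  exact StarAlgEquiv.norm_map β x

theorem car_norm_sq_le (B : A) : ‖B‖ ^ 2 ≤ ‖star B * B + B * star B‖ := by
  let : CStarAlgebra A := {}
  let := CStarAlgebra.spectralOrder A
  let := CStarAlgebra.spectralOrderedRing A
  rw [sq, ← CStarRing.norm_star_mul_self]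
  apply CStarAlgebra.norm_le_norm_of_nonneg_of_le (star_mul_self_nonneg B)
  exact le_add_of_nonneg_right (mul_star_self_nonneg B)

/-- The letter `a_j` or `a_j*`. -/
def carLetter (a : ℕ → A) (p : ℕ × Bool) : A := if p.2 then star (a p.1) else a p.1

/-- The product of the letters of a word. -/
def carWord (a : ℕ → A) (l : List (ℕ × Bool)) : A := (l.map (carLetter a)).prod

/-- The word of the adjoint. -/
def carStar (l : List (ℕ × Bool)) : List (ℕ × Bool) := (l.map (fun p => (p.1, !p.2))).reverse

/-- The word shifted by `K`. -/
def carShift (K : ℕ) (l : List (ℕ × Bool)) : List (ℕ × Bool) := l.map (fun p => (p.1 + K, p.2))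

theorem carWord_star (a : ℕ → A) (l : List (ℕ × Bool)) :
    star (carWord a l) = carWord a (carStar l) := by
  induction l with
  | nil => simp [carWord, carStar]
  | cons p l ih =>
    have h : carWord a (p :: l) = carLetter a p * carWord a l := by simp [carWord]
    rw [h, star_mul, ih]
    rcases p with ⟨i, b⟩
    cases b <;> simp [carWord, carStar, carLetter]

theorem carWord_append (a : ℕ → A) (l m : List (ℕ × Bool)) :
    carWord a (l ++ m) = carWord a l * carWord a m := by simp [carWord]

theorem carLetter_anticomm {a : ℕ → A} (ha : IsCARFamily a) (p q : ℕ × Bool) (h : p.1 ≠ q.1) :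
    carLetter a p * carLetter a q = (-1 : ℤ) • (carLetter a q * carLetter a p) := by
  obtain ⟨-, h2, h3, -⟩ := ha
  rcases p with ⟨i, b⟩
  rcases q with ⟨j, c⟩
  simp only at h
  have e1 := h2 i j h
  have e2 := h2 j i h.symm
  have e3 := h3 i j
  have e4 := congrArg star e3
  simp only [star_add, star_mul, star_zero] at e4
  cases b <;> cases c <;>
    simp only [carLetter, if_true, neg_smul, one_smul, Bool.false_eq_true, if_false]
  · exact eq_neg_of_add_eq_zero_left e3
  · exact eq_neg_of_add_eq_zero_right e2
  · exact eq_neg_of_add_eq_zero_left e1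
  · exact eq_neg_of_add_eq_zero_right e4

theorem carLetter_word {a : ℕ → A} (ha : IsCARFamily a) (p : ℕ × Bool) (m : List (ℕ × Bool))
    (h : ∀ q ∈ m, p.1 ≠ q.1) :
    carLetter a p * carWord a m = ((-1 : ℤ) ^ m.length) • (carWord a m * carLetter a p) := by
  induction m with
  | nil => simp [carWord]
  | cons q m ih =>
    have hq : carWord a (q :: m) = carLetter a q * carWord a m := by simp [carWord]
    have ih := ih (fun q hq => h q (List.mem_cons_of_mem _ hq))
    rw [hq, ← mul_assoc, carLetter_anticomm ha p q (h q List.mem_cons_self), smul_mul_assoc,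
      mul_assoc, ih, mul_smul_comm, smul_smul, List.length_cons, pow_succ', mul_assoc]

theorem carWord_comm {a : ℕ → A} (ha : IsCARFamily a) (l m : List (ℕ × Bool))
    (h : ∀ p ∈ l, ∀ q ∈ m, p.1 ≠ q.1) :
    carWord a l * carWord a m =
      ((-1 : ℤ) ^ (l.length * m.length)) • (carWord a m * carWord a l) := by
  induction l with
  | nil => simp [carWord]
  | cons p l ih =>
    have hq : carWord a (p :: l) = carLetter a p * carWord a l := by simp [carWord]
    have ih := ih (fun q hq => h q (List.mem_cons_of_mem _ hq))
    rw [hq, mul_assoc, ih, mul_smul_comm, ← mul_assoc,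
      carLetter_word ha p m (h p List.mem_cons_self), smul_mul_assoc, smul_smul, mul_assoc,
      ← pow_add, List.length_cons, Nat.succ_mul]

theorem car_exists_perm (S : Finset ℕ) (K : ℕ) (hK : ∀ i ∈ S, i < K) :
    ∃ g : Equiv.Perm ℕ, IsFinitePerm g ∧ (∀ i ∈ S, g i = i + K) ∧
      (∀ i, i ∉ S → i < K → g i = i) := by
  classical
  let f : ℕ → ℕ := fun i => if i ∈ S then i + K else if K ≤ i ∧ i - K ∈ S then i - K else i
  have hf : Function.Involutive f := by
    intro i
    by_cases h1 : i ∈ S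
    · have : i + K ∉ S := fun h => by have := hK _ h; omega
      simp [f, h1, this]
    · by_cases h2 : K ≤ i ∧ i - K ∈ S
      · have e : f i = i - K := by simp [f, h1, h2]
        rw [e]
        simp [f, h2.2, h2.1]
      · have e : f i = i := by simp only [f, if_neg h1, if_neg h2]
        rw [e, e]
  refine ⟨hf.toPerm f, ?_, ?_, ?_⟩
  · apply (Finset.finite_toSet (S ∪ S.image (· + K))).subset
    intro i hi
    simp only [Set.mem_ofPred_eq, Function.Involutive.coe_toPerm, f] at hi
    simp only [Finset.coe_union, Finset.coe_image, Set.mem_union, Finset.mem_coe, Set.mem_image]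
    by_contra hcon
    push Not at hcon
    apply hi
    rw [if_neg hcon.1, if_neg]
    rintro ⟨h1, h2⟩
    exact hcon.2 _ h2 (by omega)
  · intro i hi
    simp [f, hi]
  · intro i hi hk
    have : ¬ (K ≤ i ∧ i - K ∈ S) := by omega
    simp only [Function.Involutive.coe_toPerm, f, if_neg hi, if_neg this]

theorem car_aut_word {a : ℕ → A} (β : A ≃⋆ₐ[ℂ] A) (g : ℕ → ℕ) (l : List (ℕ × Bool))
    (h : ∀ j, β (a j) = a (g j)) :
    β (carWord a l) = carWord a (l.map (fun p => (g p.1, p.2))) := by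
  induction l with
  | nil => simp [carWord]
  | cons p l ih =>
    have hq : ∀ p l, carWord a (p :: l) = carLetter a p * carWord a l := by simp [carWord]
    rw [hq, List.map_cons, hq, map_mul, ih]
    rcases p with ⟨i, b⟩
    cases b <;> simp [carLetter, h, map_star]

/-- Shifting one word far away by a finite permutation, keeping another one. -/
theorem car_exists_shift {a : ℕ → A} {α : Equiv.Perm ℕ → (A ≃⋆ₐ[ℂ] A)}
    (hα : ∀ g : Equiv.Perm ℕ, IsFinitePerm g → ∀ j : ℕ, α g (a j) = a (g j))
    (l m : List (ℕ × Bool)) (h : ∀ p ∈ l, ∀ q ∈ m, p.1 ≠ q.1) (K : ℕ)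
    (hl : ∀ p ∈ l, p.1 < K) (hm : ∀ p ∈ m, p.1 < K) :
    ∃ g : Equiv.Perm ℕ, IsFinitePerm g ∧ α g (carWord a l) = carWord a l ∧
      α g (carWord a m) = carWord a (carShift K m) := by
  classical
  obtain ⟨g, hg, h1, h2⟩ := car_exists_perm (m.map Prod.fst).toFinset K (by
    intro i hi
    simp only [List.mem_toFinset, List.mem_map] at hi
    obtain ⟨p, hp, rfl⟩ := hi
    exact hm p hp)
  refine ⟨g, hg, ?_, ?_⟩
  · rw [car_aut_word (α g) g l (hα g hg)]
    congr 1
    conv_rhs => rw [← List.map_id l]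
    apply List.map_congr_left
    intro p hp
    have : g p.1 = p.1 := by
      apply h2 _ _ (hl p hp)
      simp only [List.mem_toFinset, List.mem_map, not_exists, not_and]
      intro q hq e
      exact h p hp q hq e.symm
    simp [this]
  · rw [car_aut_word (α g) g m (hα g hg)]
    congr 1
    apply List.map_congr_left
    intro p hp
    have : g p.1 = p.1 + K := by
      apply h1
      simp only [List.mem_toFinset, List.mem_map]
      exact ⟨p, hp, rfl⟩
    simp [this]

theorem car_bound (l : List (ℕ × Bool)) : ∃ M, ∀ p ∈ l, p.1 < M := by
  induction l with
  | nil => exact ⟨0, by simp⟩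
  | cons q l ih =>
    obtain ⟨M, hM⟩ := ih
    refine ⟨M + q.1 + 1, fun p hp => ?_⟩
    rcases List.mem_cons.mp hp with rfl | h
    · omega
    · have := hM p h; omega

/-- Two functionals that agree on words agree. -/
theorem car_ext {a : ℕ → A} (ha : IsCARFamily a) (φ ψ : WeakDual ℂ A)
    (h : ∀ l, φ (carWord a l) = ψ (carWord a l)) : φ = ψ := by
  have h4 := ha.2.2.2
  have key : ∀ x ∈ StarAlgebra.adjoin ℂ (Set.range a), φ x = ψ x := by
    intro x hx
    have hx' : x ∈ Subalgebra.toSubmodule (Algebra.adjoin ℂ (Set.range a ∪ star (Set.range a))) := by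
      rw [← StarAlgebra.adjoin_toSubalgebra]
      exact hx
    clear hx
    rw [Algebra.adjoin_eq_span] at hx'
    induction hx' using Submodule.span_induction with
    | mem x hx =>
      have : ∃ l, carWord a l = x := by
        induction hx using Submonoid.closure_induction with
        | mem x hx =>
          rcases hx with ⟨j, rfl⟩ | hx
          · exact ⟨[(j, false)], by simp [carWord, carLetter]⟩
          · obtain ⟨j, hj⟩ := hx
            exact ⟨[(j, true)], by simp [carWord, carLetter, hj]⟩
        | one => exact ⟨[], by simp [carWord]⟩
        | mul x y _ _ hx hy =>
          obtain ⟨l, rfl⟩ := hx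
          obtain ⟨m, rfl⟩ := hy
          exact ⟨l ++ m, carWord_append a l m⟩
      obtain ⟨l, rfl⟩ := this
      exact h l
    | zero => simp
    | add x y _ _ hx hy => rw [map_add, map_add, hx, hy]
    | smul c x _ hx => rw [map_smul, map_smul, hx]
  have hd : Dense ((StarAlgebra.adjoin ℂ (Set.range a) : StarSubalgebra ℂ A) : Set A) := by
    intro x
    have : x ∈ (StarAlgebra.adjoin ℂ (Set.range a)).topologicalClosure := by rw [h4]; trivial
    exact this
  apply DFunLike.coe_injective
  exact Continuous.ext_on hd φ.continuous ψ.continuous key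


theorem car_herm (ψ : WeakDual ℂ A) (h1 : ψ 1 = 1) (hp : ∀ x : A, 0 ≤ ψ (star x * x)) (x : A) :
    ψ (star x) = star (ψ x) := by
  have key : ∀ z : A, (ψ z + ψ (star z)).im = 0 := by
    intro z
    have e1 := (Complex.nonneg_iff.mp (hp (1 + z))).2
    have e2 := (Complex.nonneg_iff.mp (hp z)).2
    have : star (1 + z) * (1 + z) = 1 + (z + star z) + star z * z := by
      rw [star_add, star_one]; noncomm_ring
    rw [this, map_add, map_add, map_add, h1] at e1
    simp only [Complex.add_im, Complex.one_im] at e1 ⊢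
    linarith
  have k1 := key x
  have k2 := key (Complex.I • x)
  rw [star_smul, map_smul, map_smul] at k2
  simp at k1 k2
  apply Complex.ext
  · simp; linarith
  · simp; linarith

theorem car_cs (ψ : WeakDual ℂ A) (h1 : ψ 1 = 1) (hp : ∀ x : A, 0 ≤ ψ (star x * x)) (z : A) :
    ‖ψ z‖ ^ 2 ≤ (ψ (star z * z)).re := by
  have e1 := (Complex.nonneg_iff.mp (hp (z - ψ z • (1 : A)))).1
  have : star (z - ψ z • (1 : A)) * (z - ψ z • (1 : A)) =
      star z * z - ψ z • star z - star (ψ z) • z + (star (ψ z) * ψ z) • (1 : A) := by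
    rw [star_sub, star_smul, star_one, sub_mul, mul_sub, mul_sub]
    simp only [mul_smul_comm, smul_mul_assoc, one_mul, mul_one, smul_smul]
    rw [mul_comm (ψ z)]
    abel
  rw [this, map_add, map_sub, map_sub, map_smul, map_smul, map_smul, h1,
    car_herm ψ h1 hp] at e1
  rw [← Complex.normSq_eq_norm_sq, Complex.normSq_apply]
  simp at e1
  linarith

/-- The product property on words. -/
def CarProduct (a : ℕ → A) (ψ : WeakDual ℂ A) : Prop :=
  ∀ l m : List (ℕ × Bool), (∀ p ∈ l, ∀ q ∈ m, p.1 ≠ q.1) →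
    ψ (carWord a l * carWord a m) = ψ (carWord a l) * ψ (carWord a m)

theorem carShift_disjoint {l : List (ℕ × Bool)} {M : ℕ} (hM : ∀ p ∈ l, p.1 < M) {j k : ℕ}
    (hjk : j ≠ k) : ∀ p ∈ carShift (M * (j + 1)) l, ∀ q ∈ carShift (M * (k + 1)) l,
      p.1 ≠ q.1 := by
  intro p hp q hq
  simp only [carShift, List.mem_map] at hp hq
  obtain ⟨p, hp, rfl⟩ := hp
  obtain ⟨q, hq, rfl⟩ := hq
  have h1 := hM p hp
  have h2 := hM q hq
  simp only
  rcases lt_or_gt_of_ne hjk with h | h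
  · have := Nat.mul_le_mul_left M (show j + 1 + 1 ≤ k + 1 by omega)
    rw [Nat.mul_add M (j + 1) 1] at this
    omega
  · have := Nat.mul_le_mul_left M (show k + 1 + 1 ≤ j + 1 by omega)
    rw [Nat.mul_add M (k + 1) 1] at this
    omega

theorem carStar_mem_fst {l : List (ℕ × Bool)} {p : ℕ × Bool} (hp : p ∈ carStar l) :
    ∃ q ∈ l, q.1 = p.1 := by
  simp only [carStar, List.mem_reverse, List.mem_map] at hp
  obtain ⟨q, hq, rfl⟩ := hp
  exact ⟨q, hq, rfl⟩

theorem carStar_length (l : List (ℕ × Bool)) : (carStar l).length = l.length := by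
  simp [carStar]

theorem carShift_length (K : ℕ) (l : List (ℕ × Bool)) : (carShift K l).length = l.length := by
  simp [carShift]

theorem car_zero_of_bound {r C : ℝ} (hr : 0 ≤ r) (h : ∀ n : ℕ, (n * r) ^ 2 ≤ n * C) : r = 0 := by
  by_contra hne
  have hpos : 0 < r ^ 2 := by positivity
  obtain ⟨n, hn⟩ := exists_nat_gt (C / r ^ 2)
  rw [div_lt_iff₀ hpos] at hn
  have h0 : 0 ≤ C := by
    have := h 1
    norm_num at this
    exact (sq_nonneg r).trans this
  have hn0 : (0 : ℝ) < n := by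
    by_contra hcon
    have : (n : ℝ) = 0 := le_antisymm (not_lt.mp hcon) (Nat.cast_nonneg n)
    rw [this] at hn
    linarith
  have := h n
  have h3 : (n : ℝ) * C < n * (n * r ^ 2) := mul_lt_mul_of_pos_left hn hn0
  nlinarith

theorem car_product_unique {a : ℕ → A} (ha : IsCARFamily a)
    {α : Equiv.Perm ℕ → (A ≃⋆ₐ[ℂ] A)}
    (hα : ∀ g : Equiv.Perm ℕ, IsFinitePerm g → ∀ j : ℕ, α g (a j) = a (g j))
    {ψ φ : WeakDual ℂ A} (hψ : ψ ∈ SymmetricStatesWeakDual α)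
    (hφ : φ ∈ SymmetricStatesWeakDual α) (hprod : CarProduct a ψ)
    (D : ℝ) (hD : ∀ x : A, (φ (star x * x)).re ≤ D * (ψ (star x * x)).re) : φ = ψ := by
  apply car_ext ha
  intro l
  obtain ⟨M, hM⟩ := car_bound l
  obtain ⟨hψ1, hψ2, hψ3⟩ := hψ
  obtain ⟨hφ1, hφ2, hφ3⟩ := hφ
  set x := carWord a l with hx
  set c := ψ x with hc
  set y := x - c • (1 : A) with hy
  let X : ℕ → A := fun k => carWord a (carShift (M * (k + 1)) l)
  have hg : ∀ k : ℕ, ∃ g : Equiv.Perm ℕ, IsFinitePerm g ∧ α g x = X k := by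
    intro k
    obtain ⟨g, hg, -, h⟩ := car_exists_shift hα [] l (by simp) (M * (k + 1)) (by simp)
      (fun p hp => (hM p hp).trans_le (Nat.le_mul_of_pos_right M (Nat.succ_pos k)))
    exact ⟨g, hg, h⟩
  let Y : ℕ → A := fun k => X k - c • (1 : A)
  have hgY : ∀ k : ℕ, ∃ g : Equiv.Perm ℕ, IsFinitePerm g ∧ α g y = Y k := by
    intro k
    obtain ⟨g, hg, h⟩ := hg k
    exact ⟨g, hg, by simp only [hy, Y, map_sub, map_smul, map_one, h]⟩
  have hψX : ∀ k, ψ (X k) = c := by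
    intro k
    obtain ⟨g, hg, h⟩ := hg k
    rw [← h, hψ3 g hg]
  have hφY : ∀ k, φ (Y k) = φ y := by
    intro k
    obtain ⟨g, hg, h⟩ := hgY k
    rw [← h, hφ3 g hg]
  have hdiag : ∀ k, ψ (star (Y k) * Y k) = ψ (star y * y) := by
    intro k
    obtain ⟨g, hg, h⟩ := hgY k
    rw [← h, ← map_star, ← map_mul, hψ3 g hg]
  have hoff : ∀ j k, j ≠ k → ψ (star (Y j) * Y k) = 0 := by
    intro j k hjk
    have e : star (Y j) * Y k =
        star (X j) * X k - c • star (X j) - star c • X k + (star c * c) • (1 : A) := by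
      simp only [Y]
      rw [star_sub, star_smul, star_one, sub_mul, mul_sub, mul_sub]
      simp only [mul_smul_comm, smul_mul_assoc, one_mul, mul_one, smul_smul]
      rw [mul_comm c]
      abel
    have e2 : ψ (star (X j) * X k) = star c * c := by
      have h3 : ψ (star (X j)) = star c := by rw [car_herm ψ hψ1 hψ2, hψX]
      rw [← h3, ← hψX k]
      simp only [X]
      rw [carWord_star]
      apply hprod
      intro p hp q hq
      obtain ⟨p', hp', e⟩ := carStar_mem_fst hp
      rw [← e]
      exact carShift_disjoint hM hjk p' hp' q hq
    rw [e, map_add, map_sub, map_sub, map_smul, map_smul, map_smul, e2, hψ1,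
      car_herm ψ hψ1 hψ2, hψX, hψX]
    simp only [smul_eq_mul]
    ring
  have hzero : ‖φ y‖ = 0 := by
    apply car_zero_of_bound (C := D * (ψ (star y * y)).re) (norm_nonneg _)
    intro n
    have hs1 : φ (∑ k ∈ Finset.range n, Y k) = n * φ y := by
      rw [map_sum, Finset.sum_congr rfl (fun k _ => hφY k)]
      simp
    have hs2 : ψ (star (∑ k ∈ Finset.range n, Y k) * ∑ k ∈ Finset.range n, Y k) =
        n * ψ (star y * y) := by
      rw [star_sum, Finset.sum_mul_sum, map_sum]
      have : ∀ j ∈ Finset.range n, ψ (∑ k ∈ Finset.range n, star (Y j) * Y k) =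
          ψ (star y * y) := by
        intro j hj
        rw [map_sum, Finset.sum_eq_single_of_mem j hj (fun k _ hk => hoff j k hk.symm), hdiag]
      rw [Finset.sum_congr rfl this]
      simp
    have h1 := car_cs φ hφ1 hφ2 (∑ k ∈ Finset.range n, Y k)
    have h2 := hD (∑ k ∈ Finset.range n, Y k)
    rw [hs1] at h1
    rw [hs2] at h2
    simp at h1 h2
    rw [mul_pow]
    rw [mul_pow] at h1
    linarith
  have h0 : φ y = 0 := norm_eq_zero.mp hzero
  rw [hy, map_sub, map_smul, hφ1] at h0
  simpa [sub_eq_zero] using h0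

theorem car_product_extreme {a : ℕ → A} (ha : IsCARFamily a)
    {α : Equiv.Perm ℕ → (A ≃⋆ₐ[ℂ] A)}
    (hα : ∀ g : Equiv.Perm ℕ, IsFinitePerm g → ∀ j : ℕ, α g (a j) = a (g j))
    {ψ : WeakDual ℂ A} (hψ : ψ ∈ SymmetricStatesWeakDual α) (hprod : CarProduct a ψ) :
    ψ ∈ Set.extremePoints ℝ (SymmetricStatesWeakDual α) := by
  rw [mem_extremePoints]
  refine ⟨hψ, fun φ₁ h₁ φ₂ h₂ hseg => ?_⟩
  obtain ⟨s, t, hs, ht, hst, he⟩ := hseg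
  have hval : ∀ x : A, ψ x = s * φ₁ x + t * φ₂ x := by
    intro x
    rw [← he]
    change s • φ₁ x + t • φ₂ x = _
    simp
  have hre : ∀ x : A, (ψ (star x * x)).re = s * (φ₁ (star x * x)).re + t * (φ₂ (star x * x)).re := by
    intro x
    rw [hval]
    simp
  refine ⟨car_product_unique ha hα hψ h₁ hprod s⁻¹ fun x => ?_,
    car_product_unique ha hα hψ h₂ hprod t⁻¹ fun x => ?_⟩
  · rw [hre, mul_add, inv_mul_cancel_left₀ hs.ne']
    have := (Complex.nonneg_iff.mp (h₂.2.1 x)).1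
    have : 0 ≤ s⁻¹ * (t * (φ₂ (star x * x)).re) := by positivity
    linarith
  · rw [hre, mul_add, inv_mul_cancel_left₀ ht.ne']
    have := (Complex.nonneg_iff.mp (h₁.2.1 x)).1
    have : 0 ≤ t⁻¹ * (s * (φ₁ (star x * x)).re) := by positivity
    linarith

theorem car_odd {a : ℕ → A} (ha : IsCARFamily a)
    {α : Equiv.Perm ℕ → (A ≃⋆ₐ[ℂ] A)}
    (hα : ∀ g : Equiv.Perm ℕ, IsFinitePerm g → ∀ j : ℕ, α g (a j) = a (g j))
    {ψ : WeakDual ℂ A} (hψ : ψ ∈ SymmetricStatesWeakDual α) (l m : List (ℕ × Bool))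
    (h : ∀ p ∈ l, ∀ q ∈ m, p.1 ≠ q.1) (hodd : Odd m.length) :
    ψ (carWord a l * carWord a m) = 0 := by
  obtain ⟨M₁, hM₁⟩ := car_bound l
  obtain ⟨M₂, hM₂⟩ := car_bound m
  set M := M₁ + M₂ with hMdef
  have hMl : ∀ p ∈ l, p.1 < M := fun p hp => (hM₁ p hp).trans_le (by omega)
  have hM : ∀ p ∈ m, p.1 < M := fun p hp => (hM₂ p hp).trans_le (by omega)
  set x := carWord a l with hx
  set y := carWord a m with hy
  let Y : ℕ → A := fun k => carWord a (carShift (M * (k + 1)) m)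
  have hg : ∀ k : ℕ, ∃ g : Equiv.Perm ℕ, IsFinitePerm g ∧ α g x = x ∧ α g y = Y k := by
    intro k
    have hk : M ≤ M * (k + 1) := Nat.le_mul_of_pos_right M (Nat.succ_pos k)
    exact car_exists_shift hα l m h (M * (k + 1))
      (fun p hp => (hMl p hp).trans_le hk) (fun p hp => (hM p hp).trans_le hk)
  have hval : ∀ k, ψ (x * Y k) = ψ (x * y) := by
    intro k
    obtain ⟨g, hg, h1, h2⟩ := hg k
    rw [← hψ.2.2 g hg (x * y), map_mul (α g), h1, h2]
  have hnorm : ∀ k, ‖Y k‖ = ‖y‖ := by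
    intro k
    obtain ⟨g, hg, h1, h2⟩ := hg k
    rw [← h2, car_norm_aut]
  have hanti : ∀ j k, j ≠ k → star (Y j) * Y k + Y k * star (Y j) = 0 := by
    intro j k hjk
    simp only [Y]
    rw [carWord_star, carWord_comm ha]
    · rw [Odd.neg_one_pow]
      · simp
      · rw [carStar_length, carShift_length, carShift_length]
        exact hodd.mul hodd
    · intro p hp q hq
      obtain ⟨p', hp', e⟩ := carStar_mem_fst hp
      rw [← e]
      exact carShift_disjoint hM hjk p' hp' q hq
  have hzero : ‖ψ (x * y)‖ = 0 := by
    let ψ' : A →L[ℂ] ℂ := WeakDual.toStrongDual ψ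
    apply car_zero_of_bound (C := (‖ψ'‖ * ‖x‖) ^ 2 * (2 * ‖y‖ ^ 2)) (norm_nonneg _)
    intro n
    set B := ∑ k ∈ Finset.range n, Y k with hB
    have hs1 : ψ (x * B) = n * ψ (x * y) := by
      rw [hB, Finset.mul_sum, map_sum, Finset.sum_congr rfl (fun k _ => hval k)]
      simp
    have hs2 : star B * B + B * star B =
        ∑ k ∈ Finset.range n, (star (Y k) * Y k + Y k * star (Y k)) := by
      rw [hB, star_sum, Finset.sum_mul_sum, Finset.sum_mul_sum,
        Finset.sum_comm (f := fun i j => Y i * star (Y j)), ← Finset.sum_add_distrib]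
      apply Finset.sum_congr rfl
      intro j hj
      rw [← Finset.sum_add_distrib]
      exact Finset.sum_eq_single_of_mem j hj (fun k _ hk => hanti j k hk.symm)
    have hs3 : ‖B‖ ^ 2 ≤ n * (2 * ‖y‖ ^ 2) := by
      refine (car_norm_sq_le B).trans ?_
      rw [hs2]
      refine (norm_sum_le _ _).trans ?_
      refine (Finset.sum_le_sum (g := fun _ => 2 * ‖y‖ ^ 2) fun k _ => ?_).trans ?_
      · refine (norm_add_le _ _).trans ?_
        have h1 := norm_mul_le (star (Y k)) (Y k)
        have h2 := norm_mul_le (Y k) (star (Y k))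
        rw [norm_star, hnorm] at h1 h2
        linarith [sq ‖y‖]
      · simp
    have h4 : ‖ψ (x * B)‖ ≤ ‖ψ'‖ * ‖x‖ * ‖B‖ := by
      refine (ψ'.le_opNorm (x * B)).trans ?_
      rw [mul_assoc]
      exact mul_le_mul_of_nonneg_left (norm_mul_le _ _) (norm_nonneg _)
    rw [hs1, norm_mul, Complex.norm_natCast] at h4
    calc (n * ‖ψ (x * y)‖) ^ 2 ≤ (‖ψ'‖ * ‖x‖ * ‖B‖) ^ 2 := by gcongr
      _ = (‖ψ'‖ * ‖x‖) ^ 2 * ‖B‖ ^ 2 := by ring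
      _ ≤ (‖ψ'‖ * ‖x‖) ^ 2 * (n * (2 * ‖y‖ ^ 2)) := by gcongr
      _ = n * ((‖ψ'‖ * ‖x‖) ^ 2 * (2 * ‖y‖ ^ 2)) := by ring
  exact norm_eq_zero.mp hzero

open Filter Topology in
/-- Abstract form of the extremality argument for asymptotically central observables. -/
theorem car_even_abstract {a : ℕ → A} (ha : IsCARFamily a)
    {α : Equiv.Perm ℕ → (A ≃⋆ₐ[ℂ] A)}
    {ψ : WeakDual ℂ A} (hψ : ψ ∈ Set.extremePoints ℝ (SymmetricStatesWeakDual α))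
    (b : A) (hb : star b = b) (hbn : ‖b‖ ≤ 1 / 2) (B : ℕ → A)
    (hB : ∀ n, ∃ β : A ≃⋆ₐ[ℂ] A, B n = β b ∧ ∀ x, ψ (β x) = ψ x)
    (hfix : ∀ g, IsFinitePerm g → ∀ᶠ n in atTop, α g (B n) = B n)
    (hcomm : ∀ j, ∀ᶠ n in atTop, a j * B n = B n * a j)
    (x : A) (hx : ∀ᶠ n in atTop, ψ (x * B n) = ψ (x * b)) :
    ψ (x * b) = ψ x * ψ b := by
  rw [mem_extremePoints] at hψ
  obtain ⟨⟨h1, hpos, hsym⟩, hext⟩ := hψ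
  have hBstar : ∀ n, star (B n) = B n := by
    intro n
    obtain ⟨β, h, -⟩ := hB n
    rw [h, ← map_star, hb]
  have hBnorm : ∀ n, ‖B n‖ = ‖b‖ := by
    intro n
    obtain ⟨β, h, -⟩ := hB n
    rw [h, car_norm_aut]
  have hBψ : ∀ n, ψ (B n) = ψ b := by
    intro n
    obtain ⟨β, h, h'⟩ := hB n
    rw [h, h']
  have hD : ∀ y ∈ StarAlgebra.adjoin ℂ (Set.range a), ∀ᶠ n in atTop, y * B n = B n * y := by
    intro y hy
    induction hy using StarAlgebra.adjoin_induction with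
    | mem y hy => obtain ⟨j, rfl⟩ := hy; exact hcomm j
    | algebraMap r => exact Eventually.of_forall fun n => Algebra.commutes r (B n)
    | add y z _ _ hy hz =>
      filter_upwards [hy, hz] with n h h'
      rw [add_mul, mul_add, h, h']
    | mul y z _ _ hy hz =>
      filter_upwards [hy, hz] with n h h'
      rw [mul_assoc, h', ← mul_assoc, h, mul_assoc]
    | star y _ hy =>
      filter_upwards [hy] with n h
      have := congrArg star h
      rw [star_mul, star_mul, hBstar] at this
      exact this.symm
  have hdense : Dense ((StarAlgebra.adjoin ℂ (Set.range a) : StarSubalgebra ℂ A) : Set A) := by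
    intro x
    have : x ∈ (StarAlgebra.adjoin ℂ (Set.range a)).topologicalClosure := by
      rw [ha.2.2.2]; trivial
    exact this
  let ψ' : A →L[ℂ] ℂ := WeakDual.toStrongDual ψ
  let Φ : ℕ → WeakDual ℂ A := fun n =>
    StrongDual.toWeakDual (ψ'.comp ((ContinuousLinearMap.mul ℂ A).flip (B n)))
  have hΦ : ∀ n y, Φ n y = ψ (y * B n) := fun n y => rfl
  have hcpt := WeakDual.isCompact_closedBall (𝕜 := ℂ) (E := A) (0 : StrongDual ℂ A) (‖ψ'‖ * ‖b‖)
  have hmem : ∀ n, Φ n ∈ WeakDual.toStrongDual ⁻¹' Metric.closedBall (0 : StrongDual ℂ A)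
      (‖ψ'‖ * ‖b‖) := by
    intro n
    rw [Set.mem_preimage, mem_closedBall_zero_iff]
    apply ContinuousLinearMap.opNorm_le_bound _ (by positivity)
    intro y
    refine (ψ'.le_opNorm (y * B n)).trans ?_
    have := norm_mul_le y (B n)
    rw [hBnorm] at this
    calc ‖ψ'‖ * ‖y * B n‖ ≤ ‖ψ'‖ * (‖y‖ * ‖b‖) := by gcongr
      _ = _ := by ring
  let U : Ultrafilter ℕ := Filter.hyperfilter ℕ
  have hU : (U : Filter ℕ) ≤ atTop := by
    rw [← Nat.cofinite_eq_atTop]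
    exact Filter.hyperfilter_le_cofinite
  obtain ⟨φ, -, hφ⟩ := hcpt.ultrafilter_le_nhds (U.map Φ) (by
    rw [le_principal_iff]
    exact Filter.mem_map.mpr (Filter.univ_mem' hmem))
  have hlim : ∀ y, Tendsto (fun n => ψ (y * B n)) U (𝓝 (φ y)) := by
    intro y
    have hc : Continuous fun χ : WeakDual ℂ A => χ y := WeakDual.eval_continuous y
    exact (hc.tendsto φ).comp hφ
  have hlim_const : ∀ y c, (∀ᶠ n in atTop, ψ (y * B n) = c) → φ y = c := by
    intro y c hc
    refine tendsto_nhds_unique (hlim y) ?_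
    have hc' : ∀ᶠ n in (U : Filter ℕ), ψ (y * B n) = c := hU hc
    exact tendsto_const_nhds.congr' (hc'.mono fun n h => h.symm)
  have hφ1 : φ 1 = ψ b := by
    apply hlim_const
    exact Eventually.of_forall fun n => by rw [one_mul, hBψ]
  have hφsym : ∀ g, IsFinitePerm g → ∀ y, φ (α g y) = φ y := by
    intro g hg y
    refine tendsto_nhds_unique (hlim _) ((hlim y).congr' ?_)
    filter_upwards [hU (hfix g hg)] with n hn
    rw [← hsym g hg (y * B n), map_mul, hn]
  have hposB : ∀ (ε : ℂ), star ε = ε → ‖ε‖ ≤ 2 → ∀ y, 0 ≤ ψ (star y * y) + ε * φ (star y * y) := by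
    intro ε hε1 hε2 y
    have hcl : IsClosed {y : A | 0 ≤ ψ (star y * y) + ε * φ (star y * y)} := by
      have hc : Continuous fun y : A => ψ (star y * y) + ε * φ (star y * y) := by
        have c1 : Continuous fun y : A => star y * y := continuous_star.mul continuous_id
        exact (ψ.continuous.comp c1).add (continuous_const.mul (φ.continuous.comp c1))
      exact isClosed_Ici.preimage hc
    refine hdense.induction (P := fun y => 0 ≤ ψ (star y * y) + ε * φ (star y * y)) ?_ hcl y
    intro y hy
    obtain ⟨k, hk⟩ := car_sqrt_exists (ε • b) (by rw [star_smul, hε1, hb]) (by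
      rw [norm_smul]
      have := norm_nonneg b
      have := norm_nonneg ε
      nlinarith)
    have ht : Tendsto (fun n => ψ (star y * y) + ε * ψ (star y * y * B n)) U
        (𝓝 (ψ (star y * y) + ε * φ (star y * y))) :=
      ((hlim (star y * y)).const_mul ε).const_add _
    refine ge_of_tendsto ht ?_
    filter_upwards [hU (hD y hy)] with n hn
    obtain ⟨β, hβ, -⟩ := hB n
    have e : star (β k * y) * (β k * y) = star y * y + ε • (star y * y * B n) := by
      have e1 : star (β k) * β k = 1 + ε • B n := by
        rw [← map_star, ← map_mul, ← hk, map_add, map_one, map_smul, hβ]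
      calc star (β k * y) * (β k * y) = star y * (star (β k) * β k) * y := by
            rw [star_mul]; noncomm_ring
        _ = star y * y + ε • (star y * (B n * y)) := by
            rw [e1, mul_add, mul_one, add_mul, mul_smul_comm, smul_mul_assoc, mul_assoc]
        _ = _ := by rw [← hn, mul_assoc]
    have := hpos (β k * y)
    rw [e, map_add, map_smul] at this
    simpa using this
  have r1 := hposB 2 (by simp) (by simp) 1
  have r2 := hposB (-2) (by simp) (by simp) 1
  simp only [star_one, mul_one, h1, hφ1] at r1 r2
  rw [Complex.nonneg_iff] at r1 r2
  obtain ⟨r, hr⟩ : ∃ r : ℝ, ψ b = r := by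
    refine ⟨(ψ b).re, Complex.ext rfl ?_⟩
    have := r1.2
    simp at this ⊢
    linarith
  rw [hr] at r1 r2
  have r1' := r1.1
  have r2' := r2.1
  simp at r1' r2'
  have hs : 0 < 1 + r := by linarith
  have ht : 0 < 1 - r := by linarith
  have mkmem : ∀ (δ : ℝ), |δ| = 1 → 0 < 1 + δ * r →
      (((1 + δ * r)⁻¹ : ℝ) : ℂ) • (ψ + (δ : ℂ) • φ) ∈ SymmetricStatesWeakDual α := by
    intro δ hδ hδr
    have hv : ∀ y, ((((1 + δ * r)⁻¹ : ℝ) : ℂ) • (ψ + (δ : ℂ) • φ)) y =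
        (((1 + δ * r)⁻¹ : ℝ) : ℂ) * (ψ y + δ * φ y) := fun y => rfl
    refine ⟨?_, ?_, ?_⟩
    · rw [hv, h1, hφ1, hr]
      have : (1 + δ * r : ℝ) ≠ 0 := hδr.ne'
      norm_cast
      exact inv_mul_cancel₀ this
    · intro y
      rw [hv]
      apply mul_nonneg
      · exact_mod_cast (inv_pos.mpr hδr).le
      · apply hposB
        · simp
        · rw [Complex.norm_real, Real.norm_eq_abs, hδ]; norm_num
    · intro g hg y
      rw [hv, hv, hsym g hg, hφsym g hg]
  have m1 := mkmem 1 (by simp) (by linarith)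
  have m2 := mkmem (-1) (by simp) (by linarith)
  have hfin := (hext _ m1 _ m2 ⟨(1 + r) / 2, (1 - r) / 2, by positivity, by positivity, by ring, by
    apply DFunLike.ext
    intro y
    change ((1 + r) / 2) • ((((1 + 1 * r)⁻¹ : ℝ) : ℂ) * (ψ y + ((1 : ℝ) : ℂ) * φ y)) +
      ((1 - r) / 2) • ((((1 + -1 * r)⁻¹ : ℝ) : ℂ) * (ψ y + ((-1 : ℝ) : ℂ) * φ y)) = ψ y
    have n1 : (1 + r : ℂ) ≠ 0 := by exact_mod_cast hs.ne'
    have n2 : (1 - r : ℂ) ≠ 0 := by exact_mod_cast ht.ne'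
    have n3 : (1 + -r : ℂ) ≠ 0 := by rwa [← sub_eq_add_neg]
    simp only [Complex.real_smul]
    push_cast
    simp only [one_mul, neg_mul]
    rw [← sub_eq_add_neg, ← sub_eq_add_neg]
    field_simp
    ring⟩).1
  have hx1 := DFunLike.congr_fun hfin x
  change (((1 + 1 * r)⁻¹ : ℝ) : ℂ) * (ψ x + ((1 : ℝ) : ℂ) * φ x) = ψ x at hx1
  have n1 : (1 + r : ℂ) ≠ 0 := by exact_mod_cast hs.ne'
  push_cast at hx1
  rw [one_mul, one_mul, inv_mul_eq_iff_eq_mul₀ n1, hlim_const x _ hx] at hx1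
  rw [hr]
  linear_combination hx1

theorem car_even {a : ℕ → A} (ha : IsCARFamily a)
    {α : Equiv.Perm ℕ → (A ≃⋆ₐ[ℂ] A)}
    (hα : ∀ g : Equiv.Perm ℕ, IsFinitePerm g → ∀ j : ℕ, α g (a j) = a (g j))
    {ψ : WeakDual ℂ A} (hψ : ψ ∈ Set.extremePoints ℝ (SymmetricStatesWeakDual α))
    (l m : List (ℕ × Bool))
    (h : ∀ p ∈ l, ∀ q ∈ m, p.1 ≠ q.1) (heven : Even m.length) (z : ℂ)
    (hz : ‖z‖ * ‖carWord a m‖ ≤ 1 / 4) :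
    ψ (carWord a l * (z • carWord a m + star (z • carWord a m))) =
      ψ (carWord a l) * ψ (z • carWord a m + star (z • carWord a m)) := by
  obtain ⟨M₁, hM₁⟩ := car_bound l
  obtain ⟨M₂, hM₂⟩ := car_bound m
  have hψs : ψ ∈ SymmetricStatesWeakDual α := hψ.1
  have hg : ∀ n : ℕ, ∃ g : Equiv.Perm ℕ, IsFinitePerm g ∧ α g (carWord a l) = carWord a l ∧
      α g (carWord a m) = carWord a (carShift (M₁ + M₂ + n) m) := by
    intro n
    exact car_exists_shift hα l m h (M₁ + M₂ + n)
      (fun p hp => (hM₁ p hp).trans_le (by omega)) (fun p hp => (hM₂ p hp).trans_le (by omega))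
  let W : ℕ → A := fun n => carWord a (carShift (M₁ + M₂ + n) m)
  have hgB : ∀ n, ∃ g : Equiv.Perm ℕ, IsFinitePerm g ∧ α g (carWord a l) = carWord a l ∧
      α g (z • carWord a m + star (z • carWord a m)) = z • W n + star (z • W n) := by
    intro n
    obtain ⟨g, hg, e1, e2⟩ := hg n
    refine ⟨g, hg, e1, ?_⟩
    rw [map_add, map_star, map_smul, e2]
  refine car_even_abstract ha hψ _ ?_ ?_ (fun n => z • W n + star (z • W n)) ?_ ?_ ?_ _ ?_
  · rw [star_add, star_star, add_comm]
  · refine (norm_add_le _ _).trans ?_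
    rw [norm_star, norm_smul]
    linarith
  · intro n
    obtain ⟨g, hg, e1, e2⟩ := hgB n
    exact ⟨α g, e2.symm, hψs.2.2 g hg⟩
  · intro g hg
    obtain ⟨N, hN⟩ := hg.bddAbove
    filter_upwards [Filter.eventually_gt_atTop N] with n hn
    have : α g (W n) = W n := by
      simp only [W]
      rw [car_aut_word (α g) g _ (hα g hg)]
      congr 1
      conv_rhs => rw [← List.map_id (carShift (M₁ + M₂ + n) m)]
      apply List.map_congr_left
      intro p hp
      have : g p.1 = p.1 := by
        by_contra hne
        have h1 := hN hne
        simp only [carShift, List.mem_map] at hp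
        obtain ⟨q, hq, rfl⟩ := hp
        simp only at h1
        omega
      simp [this]
    rw [map_add, map_star, map_smul, this]
  · intro j
    filter_upwards [Filter.eventually_gt_atTop j] with n hn
    have hc : ∀ c, carLetter a (j, c) * W n = W n * carLetter a (j, c) := by
      intro c
      simp only [W]
      rw [carLetter_word ha, carShift_length, heven.neg_one_pow, one_smul]
      intro q hq
      simp only [carShift, List.mem_map] at hq
      obtain ⟨p, hp, rfl⟩ := hq
      simp only
      omega
    have c1 : a j * W n = W n * a j := by simpa [carLetter] using hc false
    have c2 : star (a j) * W n = W n * star (a j) := by simpa [carLetter] using hc true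
    have c3 : a j * star (W n) = star (W n) * a j := by
      have := congrArg star c2
      simp only [star_mul, star_star] at this
      exact this.symm
    rw [star_smul, mul_add, add_mul, mul_smul_comm, smul_mul_assoc, c1, mul_smul_comm,
      smul_mul_assoc, c3]
  · refine Filter.Eventually.of_forall fun n => ?_
    obtain ⟨g, hg, e1, e2⟩ := hgB n
    rw [← hψs.2.2 g hg (carWord a l * (z • carWord a m + star (z • carWord a m))),
      map_mul (α g), e1, e2]

theorem car_extreme_product {a : ℕ → A} (ha : IsCARFamily a)
    {α : Equiv.Perm ℕ → (A ≃⋆ₐ[ℂ] A)}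
    (hα : ∀ g : Equiv.Perm ℕ, IsFinitePerm g → ∀ j : ℕ, α g (a j) = a (g j))
    {ψ : WeakDual ℂ A} (hψ : ψ ∈ Set.extremePoints ℝ (SymmetricStatesWeakDual α)) :
    CarProduct a ψ := by
  intro l m h
  rcases Nat.even_or_odd m.length with he | ho
  · obtain ⟨t, ht, hle⟩ : ∃ t : ℝ, 0 < t ∧ t * ‖carWord a m‖ ≤ 1 / 4 := by
      refine ⟨1 / (4 * (‖carWord a m‖ + 1)), by positivity, ?_⟩
      rw [div_mul_eq_mul_div, div_le_div_iff₀ (by positivity) (by norm_num)]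
      linarith [norm_nonneg (carWord a m)]
    have e1 := car_even ha hα hψ l m h he (t : ℂ) (by
      rw [Complex.norm_real, Real.norm_eq_abs, abs_of_pos ht]; exact hle)
    have e2 := car_even ha hα hψ l m h he (t * Complex.I) (by
      rw [norm_mul, Complex.norm_I, mul_one, Complex.norm_real, Real.norm_eq_abs, abs_of_pos ht]
      exact hle)
    have t0 : (t : ℂ) ≠ 0 := by exact_mod_cast ht.ne'
    simp only [star_smul, mul_add, mul_smul_comm, map_add, map_smul, smul_eq_mul, star_mul',
      Complex.star_def, Complex.conj_ofReal, Complex.conj_I] at e1 e2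
    apply mul_left_cancel₀ t0
    linear_combination (1 / 2 : ℂ) * e1 - (Complex.I / 2) * e2 +
      (t / 2 : ℂ) * (ψ (carWord a l * carWord a m) - ψ (carWord a l * star (carWord a m)) -
        ψ (carWord a l) * (ψ (carWord a m) - ψ (star (carWord a m)))) * Complex.I_sq
  · rw [car_odd ha hα hψ.1 l m h ho]
    have := car_odd ha hα hψ.1 [] m (by simp) ho
    simp only [carWord, List.map_nil, List.prod_nil, one_mul] at this
    simp only [carWord]
    rw [this, mul_zero]

theorem car_symm_closed (α : Equiv.Perm ℕ → (A ≃⋆ₐ[ℂ] A)) :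
    IsClosed (SymmetricStatesWeakDual α) := by
  have ev : ∀ x : A, Continuous fun χ : WeakDual ℂ A => χ x := WeakDual.eval_continuous
  have : SymmetricStatesWeakDual α = {ψ : WeakDual ℂ A | ψ 1 = 1} ∩
      ((⋂ x : A, {ψ : WeakDual ℂ A | 0 ≤ ψ (star x * x)}) ∩
      ⋂ g : Equiv.Perm ℕ, ⋂ _ : IsFinitePerm g, ⋂ x : A, {ψ : WeakDual ℂ A | ψ (α g x) = ψ x}) := by
    ext ψ
    simp only [SymmetricStatesWeakDual, Set.mem_inter_iff, Set.mem_iInter, Set.mem_ofPred_eq]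
  rw [this]
  refine (isClosed_eq (ev 1) continuous_const).inter (IsClosed.inter ?_ ?_)
  · exact isClosed_iInter fun x => isClosed_Ici.preimage (ev (star x * x))
  · exact isClosed_iInter fun g => isClosed_iInter fun _ => isClosed_iInter fun x =>
      isClosed_eq (ev _) (ev _)

theorem car_product_closed (a : ℕ → A) : IsClosed {ψ : WeakDual ℂ A | CarProduct a ψ} := by
  have ev : ∀ x : A, Continuous fun χ : WeakDual ℂ A => χ x := WeakDual.eval_continuous
  simp only [CarProduct, Set.ofPred_forall]
  exact isClosed_iInter fun l => isClosed_iInter fun m => isClosed_iInter fun _ =>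
      isClosed_eq (ev _) ((ev _).mul (ev _))

end helpers

/-- The set of extreme points of the convex set of symmetric states on the CAR algebra
over the positive integers is weak-* closed. -/
theorem extreme_symmetric_states_isClosed {A : Type*}
    [NormedRing A] [StarRing A] [CStarRing A] [NormedAlgebra ℂ A] [StarModule ℂ A]
    [CompleteSpace A]
    (a : ℕ → A) (ha : IsCARFamily a)
    (α : Equiv.Perm ℕ → (A ≃⋆ₐ[ℂ] A))
    (hα : ∀ g : Equiv.Perm ℕ, IsFinitePerm g → ∀ j : ℕ, α g (a j) = a (g j)) :
    IsClosed (Set.extremePoints ℝ (SymmetricStatesWeakDual α)) := by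
  have key : Set.extremePoints ℝ (SymmetricStatesWeakDual α) =
      SymmetricStatesWeakDual α ∩ {ψ : WeakDual ℂ A | CarProduct a ψ} := by
    ext ψ
    exact ⟨fun h => ⟨h.1, car_extreme_product ha hα h⟩,
      fun h => car_product_extreme ha hα h.1 h.2⟩
  rw [key]
  exact (car_symm_closed α).inter (car_product_closed a)
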